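/- arXiv:1812.11474 — 9 statements merged into one kernel-verified Lean document; each statement's English description precedes it below -/
import Mathlib

section
/- Let X and Y be finite simple graphs and let A be a unital *-ring containing an Iso(X,Y)-family (e_{x,y}). Then e_{g,h} = e_{h,g} for every g ∈ V(X) and h ∈ V(Y). -/
open Finset

/-- The `rel` function of a pair of graphs, defined on the disjoint union of the vertex
sets: `0` if the vertices are equal, `-1` if adjacent, `+1` if distinct and non-adjacent
(within one graph); the junk value `2` for mixed pairs. -/
def relS {VX VY : Type*} [DecidableEq VX] [DecidableEq VY]
    (X : SimpleGraph VX) (Y : SimpleGraph VY)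
    [DecidableRel X.Adj] [DecidableRel Y.Adj] :
    VX ⊕ VY → VX ⊕ VY → ℤ
  | Sum.inl v, Sum.inl w => if v = w then 0 else if X.Adj v w then -1 else 1
  | Sum.inr v, Sum.inr w => if v = w then 0 else if Y.Adj v w then -1 else 1
  | _, _ => 2

/-- The rules of the graph isomorphism game `Iso(X,Y)`: on inputs `v, w` and outputs
`x, y`, the players win iff all the listed conditions hold. -/
def isoRule {VX VY : Type*} [DecidableEq VX] [DecidableEq VY]
    (X : SimpleGraph VX) (Y : SimpleGraph VY)
    [DecidableRel X.Adj] [DecidableRel Y.Adj]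
    (v w x y : VX ⊕ VY) : Prop :=
  x.isLeft ≠ v.isLeft ∧ y.isLeft ≠ w.isLeft ∧
  (v.isLeft = w.isLeft → relS X Y v w = relS X Y x y) ∧
  (v.isLeft ≠ w.isLeft → x = w → y = v) ∧
  (v.isLeft ≠ w.isLeft → y = v → x = w)

/-- An `Iso(X,Y)`-family in a unital `*`-ring `A`: self-adjoint idempotents `e x y`
indexed by the disjoint union of the vertex sets, with each row summing to `1`,
orthogonality along rows, and the products prescribed to vanish whenever the
corresponding input-output quadruple violates the rules of the isomorphism game. -/
structure IsoFamily {VX VY : Type*} [Fintype VX] [Fintype VY]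
    [DecidableEq VX] [DecidableEq VY]
    (X : SimpleGraph VX) (Y : SimpleGraph VY)
    [DecidableRel X.Adj] [DecidableRel Y.Adj]
    (A : Type*) [Ring A] [StarRing A] where
  e : (VX ⊕ VY) → (VX ⊕ VY) → A
  selfadj : ∀ x y, star (e x y) = e x y
  idem : ∀ x y, e x y * e x y = e x y
  rowsum : ∀ x, ∑ y, e x y = 1
  row_orth : ∀ x y y', y ≠ y' → e x y * e x y' = 0
  rule : ∀ v w x y, ¬ isoRule X Y v w x y → e v x * e w y = 0

/-- in an `Iso(X,Y)`-family, `e (g,h) = e (h,g)` for `g ∈ V(X)`, `h ∈ V(Y)`. -/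
theorem stmt1 {VX VY : Type*} [Fintype VX] [Fintype VY]
    [DecidableEq VX] [DecidableEq VY]
    (X : SimpleGraph VX) (Y : SimpleGraph VY)
    [DecidableRel X.Adj] [DecidableRel Y.Adj]
    (A : Type*) [Ring A] [StarRing A]
    (E : IsoFamily X Y A) :
    ∀ (g : VX) (h : VY), E.e (Sum.inl g) (Sum.inr h) = E.e (Sum.inr h) (Sum.inl g) := by
  intro g h
  have h_left : E.e (Sum.inl g) (Sum.inr h) * E.e (Sum.inr h) (Sum.inl g)
      = E.e (Sum.inl g) (Sum.inr h) := by
    conv_rhs => rw [← mul_one (E.e (Sum.inl g) (Sum.inr h)), ← E.rowsum (Sum.inr h),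
      Finset.mul_sum]
    symm
    refine Finset.sum_eq_single (Sum.inl g) (fun y _ hy => ?_) (by simp)
    exact E.rule _ _ _ _ fun hr => hy (hr.2.2.2.1 (by simp) rfl)
  have h_right : E.e (Sum.inl g) (Sum.inr h) * E.e (Sum.inr h) (Sum.inl g)
      = E.e (Sum.inr h) (Sum.inl g) := by
    conv_rhs => rw [← one_mul (E.e (Sum.inr h) (Sum.inl g)), ← E.rowsum (Sum.inl g),
      Finset.sum_mul]
    symm
    refine Finset.sum_eq_single (Sum.inr h) (fun x _ hx => ?_) (by simp)
    exact E.rule _ _ _ _ fun hr => hx (hr.2.2.2.2 (by simp) rfl)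
  exact h_left.symm.trans h_right
end

section
/- Let X and Y be finite simple graphs and let A be a unital *-ring containing an Iso(X,Y)-family (e_{x,y}). Then Σ_{g ∈ V(X)} e_{g,h} = 1 for every h ∈ V(Y), and e_{g,h} e_{g',h} = 0 for all g ≠ g' in V(X) and all h ∈ V(Y). -/
open Finset

namespace IsoFamily

variable {VX VY : Type*} [Fintype VX] [Fintype VY] [DecidableEq VX] [DecidableEq VY]
  {X : SimpleGraph VX} {Y : SimpleGraph VY} [DecidableRel X.Adj] [DecidableRel Y.Adj]
  {A : Type*} [Ring A] [StarRing A]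

/-- An entry whose two indices lie in the same graph vanishes. -/
theorem e_eq_zero_of_isLeft_eq (E : IsoFamily X Y A) {v x : VX ⊕ VY}
    (h : x.isLeft = v.isLeft) : E.e v x = 0 := by
  rw [← E.idem v x]
  exact E.rule v v x x fun hr => hr.1 h

/-- Entries with indices in different graphs are symmetric in these indices. -/
theorem e_symm (E : IsoFamily X Y A) {v w : VX ⊕ VY} (h : v.isLeft ≠ w.isLeft) :
    E.e v w = E.e w v := by
  have h₁ : E.e v w = E.e v w * E.e w v := by
    calc E.e v w = ∑ y, E.e v w * E.e w y := by rw [← mul_sum, E.rowsum, mul_one]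
      _ = E.e v w * E.e w v := Fintype.sum_eq_single v fun y hy =>
        E.rule v w w y fun hr => hy (hr.2.2.2.1 h rfl)
  have h₂ : E.e w v = E.e v w * E.e w v := by
    calc E.e w v = ∑ x, E.e v x * E.e w v := by rw [← sum_mul, E.rowsum, one_mul]
      _ = E.e v w * E.e w v := Fintype.sum_eq_single w fun x hx =>
        E.rule v w x v fun hr => hx (hr.2.2.2.2 h rfl)
  exact h₁.trans h₂.symm

end IsoFamily

/-- in an `Iso(X,Y)`-family, columns sum to `1` and entries in a common
column are orthogonal. -/
theorem stmt2 {VX VY : Type*} [Fintype VX] [Fintype VY]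
    [DecidableEq VX] [DecidableEq VY]
    (X : SimpleGraph VX) (Y : SimpleGraph VY)
    [DecidableRel X.Adj] [DecidableRel Y.Adj]
    (A : Type*) [Ring A] [StarRing A]
    (E : IsoFamily X Y A) :
    (∀ h : VY, ∑ g : VX, E.e (Sum.inl g) (Sum.inr h) = 1) ∧
    (∀ (g g' : VX) (h : VY), g ≠ g' →
      E.e (Sum.inl g) (Sum.inr h) * E.e (Sum.inl g') (Sum.inr h) = 0) := by
  refine ⟨fun h => ?_, fun g g' h hg => E.rule _ _ _ _ fun hr => ?_⟩
  · have hzero : ∑ y, E.e (Sum.inr h) (Sum.inr y) = 0 :=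
      sum_eq_zero fun y _ => E.e_eq_zero_of_isLeft_eq rfl
    rw [← E.rowsum (Sum.inr h), Fintype.sum_sum_type, hzero, add_zero]
    exact sum_congr rfl fun g _ => E.e_symm (by simp)
  · have := hr.2.2.1 rfl
    simp only [relS, if_neg hg, if_true] at this
    grind
end

section
/- Let X and Y be finite simple graphs and let A be a unital *-ring containing an Iso(X,Y)-family (e_{x,y}). Then for every g ∈ V(X) and h ∈ V(Y), Σ_{g' : (g,g') ∈ E(X)} e_{g',h} = Σ_{h' : (h,h') ∈ E(Y)} e_{g,h'}. -/
open Finset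

namespace IsoFamily

variable {VX VY : Type*} [Fintype VX] [Fintype VY] [DecidableEq VX] [DecidableEq VY]
  {X : SimpleGraph VX} {Y : SimpleGraph VY} [DecidableRel X.Adj] [DecidableRel Y.Adj]
  {A : Type*} [Ring A] [StarRing A]

/-- Entries between two vertices of the same graph vanish. -/
lemma e_eq_zero (E : IsoFamily X Y A) {v x : VX ⊕ VY} (hvx : x.isLeft = v.isLeft) :
    E.e v x = 0 := by
  rw [← E.idem v x]
  exact E.rule _ _ _ _ fun h => h.1 hvx

lemma sum_e_inl (E : IsoFamily X Y A) (g : VX) :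
    ∑ h, E.e (Sum.inl g) (Sum.inr h) = 1 := by
  have h := E.rowsum (Sum.inl g)
  have h₀ : ∑ g', E.e (Sum.inl g) (Sum.inl g') = 0 :=
    Finset.sum_eq_zero fun _ _ => E.e_eq_zero rfl
  rwa [Fintype.sum_sum_type, h₀, zero_add] at h

/-- The family is symmetric. -/
lemma e_comm (E : IsoFamily X Y A) (v x : VX ⊕ VY) : E.e v x = E.e x v := by
  by_cases hvx : x.isLeft = v.isLeft
  · rw [E.e_eq_zero hvx, E.e_eq_zero hvx.symm]
  · have h₁ : E.e v x = E.e v x * E.e x v := by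
      conv_lhs => rw [← mul_one (E.e v x), ← E.rowsum x, Finset.mul_sum]
      exact Finset.sum_eq_single_of_mem v (Finset.mem_univ v) fun y _ hy =>
        E.rule _ _ _ _ fun h => hy (h.2.2.2.1 (Ne.symm hvx) rfl)
    have h₂ : E.e x v = E.e v x * E.e x v := by
      conv_lhs => rw [← one_mul (E.e x v), ← E.rowsum v, Finset.sum_mul]
      exact Finset.sum_eq_single_of_mem x (Finset.mem_univ x) fun y _ hy =>
        E.rule _ _ _ _ fun h => hy (h.2.2.2.2 (Ne.symm hvx) rfl)
    rw [h₁, ← h₂]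

lemma sum_e_inr (E : IsoFamily X Y A) (h : VY) :
    ∑ g, E.e (Sum.inl g) (Sum.inr h) = 1 := by
  have hs := E.rowsum (Sum.inr h)
  have h₀ : ∑ h', E.e (Sum.inr h) (Sum.inr h') = 0 :=
    Finset.sum_eq_zero fun _ _ => E.e_eq_zero rfl
  rw [Fintype.sum_sum_type, h₀, add_zero] at hs
  simpa only [E.e_comm (Sum.inr h)] using hs

lemma e_mul_e_eq_zero (E : IsoFamily X Y A) {g g' : VX} {h h' : VY}
    (hadj : ¬(X.Adj g g' ↔ Y.Adj h h')) :
    E.e (Sum.inl g') (Sum.inr h) * E.e (Sum.inl g) (Sum.inr h') = 0 := by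
  refine E.rule _ _ _ _ fun hr => hadj ?_
  have hrel := hr.2.2.1 rfl
  rw [X.adj_comm g g']
  simp only [relS] at hrel
  have hX := X.loopless.irrefl g
  have hY := Y.loopless.irrefl h'
  split_ifs at hrel <;> simp_all

end IsoFamily

/-- for every `g ∈ V(X)`, `h ∈ V(Y)`,
`Σ_{g' ~ g} e (g',h) = Σ_{h' ~ h} e (g,h')`. -/
theorem stmt3 {VX VY : Type*} [Fintype VX] [Fintype VY]
    [DecidableEq VX] [DecidableEq VY]
    (X : SimpleGraph VX) (Y : SimpleGraph VY)
    [DecidableRel X.Adj] [DecidableRel Y.Adj]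
    (A : Type*) [Ring A] [StarRing A]
    (E : IsoFamily X Y A) :
    ∀ (g : VX) (h : VY),
      ∑ g' ∈ X.neighborFinset g, E.e (Sum.inl g') (Sum.inr h) =
      ∑ h' ∈ Y.neighborFinset h, E.e (Sum.inl g) (Sum.inr h') := by
  intro g h
  have key : ∀ g' ∈ X.neighborFinset g,
      E.e (Sum.inl g') (Sum.inr h) =
        ∑ h' ∈ Y.neighborFinset h, E.e (Sum.inl g') (Sum.inr h) * E.e (Sum.inl g) (Sum.inr h') := by
    intro g' hg'
    conv_lhs => rw [← mul_one (E.e _ _), ← E.sum_e_inl g, Finset.mul_sum]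
    refine (Finset.sum_subset (Finset.subset_univ _) fun h' _ hh' => ?_).symm
    rw [SimpleGraph.mem_neighborFinset] at hg' hh'
    exact E.e_mul_e_eq_zero fun hiff => hh' (hiff.1 hg')
  have key' : ∀ h' ∈ Y.neighborFinset h,
      E.e (Sum.inl g) (Sum.inr h') =
        ∑ g' ∈ X.neighborFinset g, E.e (Sum.inl g') (Sum.inr h) * E.e (Sum.inl g) (Sum.inr h') := by
    intro h' hh'
    conv_lhs => rw [← one_mul (E.e _ _), ← E.sum_e_inr h, Finset.sum_mul]
    refine (Finset.sum_subset (Finset.subset_univ _) fun g' _ hg' => ?_).symm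
    rw [SimpleGraph.mem_neighborFinset] at hg' hh'
    exact E.e_mul_e_eq_zero fun hiff => hg' (hiff.2 hh')
  rw [Finset.sum_congr rfl key, Finset.sum_congr rfl key', Finset.sum_comm]
end

section
/- Let G₁ and G₂ be finite simple graphs on the vertex set {1,…,n} with adjacency matrices A₁ and A₂, let A be a unital complex *-algebra, and let P = (p_{ij}) be an n × n magic unitary over A satisfying A₁P = PA₂ (where A₁, A₂ are regarded as matrices with entries in A via the 0-1 entries). If p_{ij} ≠ 0, then the degree of vertex i in G₁ equals the degree of vertex j in G₂. -/
open Finset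

/-- Summing row `i` of `A₁P = PA₂` expresses the degree of `i` as a combination of degrees
in `G₂`, when the rows of `P` sum to `1`. -/
theorem degree_eq_sum_mul_degree {V R : Type*} [Fintype V] [Ring R] (G₁ G₂ : SimpleGraph V)
    [DecidableRel G₁.Adj] [DecidableRel G₂.Adj] (P : Matrix V V R)
    (hrow : ∀ i, ∑ j, P i j = 1)
    (hint : G₁.adjMatrix R * P = P * G₂.adjMatrix R) (i : V) :
    (G₁.degree i : R) = ∑ k, P i k * (G₂.degree k : R) := by
  have hP : P.mulVec (Function.const V 1) = Function.const V 1 := by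
    ext i
    simp [Matrix.mulVec, dotProduct, hrow]
  have h := congrArg (fun M : Matrix V V R => M.mulVec (Function.const V 1) i) hint
  simp only [← Matrix.mulVec_mulVec, hP] at h
  rw [SimpleGraph.adjMatrix_mulVec_const_apply, mul_one] at h
  rw [h, Matrix.mulVec, dotProduct]
  simp only [SimpleGraph.adjMatrix_mulVec_const_apply, mul_one]

/-- if a magic unitary `P` over a unital complex `*`-algebra intertwines the
adjacency matrices of two graphs `G₁, G₂` on `{1,…,n}` (`A₁P = PA₂`) and `p_{ij} ≠ 0`,
then vertex `i` of `G₁` and vertex `j` of `G₂` have the same degree. -/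
theorem stmt5 {n : ℕ} (G₁ G₂ : SimpleGraph (Fin n))
    [DecidableRel G₁.Adj] [DecidableRel G₂.Adj]
    (A : Type*) [Ring A] [Algebra ℂ A] [StarRing A]
    (P : Matrix (Fin n) (Fin n) A)
    (hsa : ∀ i j, star (P i j) = P i j)
    (hidem : ∀ i j, P i j * P i j = P i j)
    (hrow : ∀ i, ∑ j, P i j = 1)
    (hcol : ∀ j, ∑ i, P i j = 1)
    (hrow_orth : ∀ i j k, j ≠ k → P i j * P i k = 0)
    (hcol_orth : ∀ i k j, i ≠ k → P i j * P k j = 0)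
    (hint : (Matrix.of fun i j => if G₁.Adj i j then (1 : A) else 0) * P =
            P * (Matrix.of fun i j => if G₂.Adj i j then (1 : A) else 0))
    (i j : Fin n) (hij : P i j ≠ 0) :
    G₁.degree i = G₂.degree j := by
  have hdeg := degree_eq_sum_mul_degree G₁ G₂ P hrow hint i
  have hmul : (G₁.degree i : A) * P i j = (G₂.degree j : A) * P i j := by
    rw [hdeg, sum_mul, sum_eq_single j]
    · rw [← Nat.cast_comm, mul_assoc, hidem]
    · intro k _ hk
      rw [← Nat.cast_comm, mul_assoc, hrow_orth i k j hk, mul_zero]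
    · simp
  have hsmul : (G₁.degree i : ℂ) • P i j = (G₂.degree j : ℂ) • P i j := by
    simpa [Algebra.smul_def] using hmul
  exact_mod_cast smul_left_injective ℂ hij hsmul
end

section
/- Let A be a unital *-ring containing self-adjoint idempotents e_{x,a} for x ∈ {1,…,5} and a ∈ {1,…,4} satisfying: e_{x,a} e_{x,b} = 0 whenever a ≠ b; Σ_{a=1}^4 e_{x,a} = 1 for every x; and e_{x,a} e_{y,a} = 0 whenever x ≠ y. Then for each a the element p_a := Σ_{x=1}^5 e_{x,a} is a self-adjoint idempotent, and the self-adjoint idempotents q_a := 1 − p_a satisfy Σ_{a=1}^4 q_a = −1. In particular, in a *-ring it is possible for four self-adjoint idempotents to sum to −1. -/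
open Finset

/-- given the relations of the game `*`-algebra `𝒜(Hom(K₅,K₄))`, the elements
`p a = Σ_x e x a` are self-adjoint idempotents, and the self-adjoint idempotents
`q a = 1 - p a` satisfy `Σ_a q a = -1`: four self-adjoint idempotents in a `*`-ring can
sum to `-1`. -/
theorem stmt8 (R : Type*) [Ring R] [StarRing R]
    (e : Fin 5 → Fin 4 → R)
    (hsa : ∀ x a, star (e x a) = e x a)
    (hidem : ∀ x a, e x a * e x a = e x a)
    (horth : ∀ x a b, a ≠ b → e x a * e x b = 0)
    (hsum : ∀ x, ∑ a, e x a = 1)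
    (hgraph : ∀ x y a, x ≠ y → e x a * e y a = 0) :
    (∀ a, star (∑ x, e x a) = ∑ x, e x a ∧
      (∑ x, e x a) * (∑ x, e x a) = ∑ x, e x a) ∧
    (∀ a, star (1 - ∑ x, e x a) = 1 - ∑ x, e x a ∧
      (1 - ∑ x, e x a) * (1 - ∑ x, e x a) = 1 - ∑ x, e x a) ∧
    (∑ a : Fin 4, (1 - ∑ x, e x a) = -1) := by
  have star_p : ∀ a, star (∑ x, e x a) = ∑ x, e x a := fun a => by
    simp only [star_sum, hsa]
  have idem_p : ∀ a, IsIdempotentElem (∑ x, e x a) := fun a => by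
    rw [IsIdempotentElem, Finset.sum_mul_sum]
    refine Finset.sum_congr rfl fun x _ => ?_
    rw [Finset.sum_eq_single x (fun y _ hy => hgraph x y a hy.symm) (by simp), hidem]
  refine ⟨fun a => ⟨star_p a, idem_p a⟩, fun a => ⟨?_, (idem_p a).one_sub⟩, ?_⟩
  · rw [star_sub, star_one, star_p]
  · rw [Finset.sum_sub_distrib, Finset.sum_comm]
    simp only [hsum, Finset.sum_const, Finset.card_univ, Fintype.card_fin, nsmul_eq_mul, mul_one]
    norm_num
end

section
/- Let R be a ring in which 2 is invertible (for instance an algebra over ℚ), and let p, q, r ∈ R be idempotents with p + q + r = 1. Then p, q, r are pairwise orthogonal: pq = qp = 0, pr = rp = 0, and qr = rq = 0. -/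
/-- If `2` is invertible and `e`, `f`, `g` are idempotents with `e + f + g = 1`,
then `e * f = 0`. -/
theorem IsIdempotentElem.mul_eq_zero_of_add_add_eq_one {R : Type*} [Ring R] [Invertible (2 : R)]
    {e f g : R} (he : IsIdempotentElem e) (hf : IsIdempotentElem f) (hg : IsIdempotentElem g)
    (hsum : e + f + g = 1) : e * f = 0 := by
  have hef : IsIdempotentElem (e + f) := by
    rw [eq_sub_of_add_eq hsum]
    exact hg.one_sub
  have anti : e * f + f * e = 0 := by
    have h := hef.eq
    rw [add_mul, mul_add, mul_add, he.eq, hf.eq] at h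
    have h' : e * f + f * e = (e + e * f + (f * e + f)) - (e + f) := by abel
    rw [h', h, sub_self]
  have left : e * f + e * f * e = 0 := by
    simpa [mul_add, ← mul_assoc, he.eq] using congrArg (e * ·) anti
  have right : e * f * e + f * e = 0 := by
    simpa [add_mul, mul_assoc, he.eq] using congrArg (· * e) anti
  have comm : e * f = f * e := by
    rw [eq_neg_of_add_eq_zero_left left, eq_neg_of_add_eq_zero_right right]
  rw [← comm, ← two_mul] at anti
  exact (isUnit_of_invertible (2 : R)).mul_right_eq_zero.mp anti

/-- in a ring in which `2` is invertible, three idempotents summing to `1`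
are pairwise orthogonal. -/
theorem stmt9 (R : Type*) [Ring R] [Invertible (2 : R)]
    (p q r : R) (hp : p * p = p) (hq : q * q = q) (hr : r * r = r)
    (hsum : p + q + r = 1) :
    p * q = 0 ∧ q * p = 0 ∧ p * r = 0 ∧ r * p = 0 ∧ q * r = 0 ∧ r * q = 0 := by
  refine ⟨IsIdempotentElem.mul_eq_zero_of_add_add_eq_one hp hq hr ?_,
    IsIdempotentElem.mul_eq_zero_of_add_add_eq_one hq hp hr ?_,
    IsIdempotentElem.mul_eq_zero_of_add_add_eq_one hp hr hq ?_,
    IsIdempotentElem.mul_eq_zero_of_add_add_eq_one hr hp hq ?_,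
    IsIdempotentElem.mul_eq_zero_of_add_add_eq_one hq hr hp ?_,
    IsIdempotentElem.mul_eq_zero_of_add_add_eq_one hr hq hp ?_⟩ <;>
  · refine Eq.trans ?_ hsum
    abel
end

section
/- Let Γ be a k-regular simple graph on a vertex set V with |V| = 2m, and let S ⊆ V with |S| = m. Let Γ' be the graph on V ∪ {v₀} obtained by adding a new vertex v₀ adjacent exactly to the vertices in S, and let Γ'' be the graph on V ∪ {v₀} obtained by adding v₀ adjacent exactly to the vertices in V \ S (the edges among vertices of V being those of Γ in both cases). Then Γ' and Γ'' are isospectral: their adjacency matrices have the same characteristic polynomial. -/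
open Finset

/-- Two matrices over a domain that are intertwined by a matrix with nonzero determinant
have the same characteristic polynomial. -/
theorem Matrix.charpoly_eq_of_mul_eq_mul {R n : Type*} [CommRing R] [IsDomain R] [Fintype n]
    [DecidableEq n] {M N P : Matrix n n R} (h : M * P = P * N) (hP : P.det ≠ 0) :
    M.charpoly = N.charpoly := by
  have hdet : (Polynomial.C.mapMatrix P).det ≠ 0 := by
    rw [← RingHom.map_det]
    exact Polynomial.C_ne_zero.mpr hP
  have hchar : M.charmatrix * Polynomial.C.mapMatrix P =
      Polynomial.C.mapMatrix P * N.charmatrix := by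
    simp only [Matrix.charmatrix, sub_mul, mul_sub, ← map_mul, h]
    rw [(Matrix.scalar_commute _ (Commute.all _) _).eq]
  have := congrArg Matrix.det hchar
  rw [Matrix.det_mul, Matrix.det_mul, mul_comm] at this
  exact mul_left_cancel₀ hdet this

/-- The multiple by `m` of the Godsil–McKay switching matrix: the block diagonal matrix with
blocks `J - m I` on `V` and `m` on the added vertex. -/
def switchingMatrix (V : Type*) [DecidableEq V] (m : ℕ) : Matrix (Option V) (Option V) ℤ :=
  Matrix.of fun a b =>
    a.elim (b.elim (m : ℤ) fun _ => 0) fun v => b.elim 0 fun w => 1 - if v = w then (m : ℤ) else 0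

theorem switchingMatrix_mul_self (V : Type*) [Fintype V] [DecidableEq V] (m : ℕ)
    (hcard : Fintype.card V = 2 * m) :
    switchingMatrix V m * switchingMatrix V m = ((m : ℤ) ^ 2) • 1 := by
  ext a b
  rcases a with _ | v <;> rcases b with _ | w
  · simp [switchingMatrix, Matrix.mul_apply, Fintype.sum_option, sq]
  · simp [switchingMatrix, Matrix.mul_apply, Fintype.sum_option]
  · simp [switchingMatrix, Matrix.mul_apply, Fintype.sum_option]
  · simp only [switchingMatrix, Option.elim_some, Option.elim_none, Matrix.mul_apply,
      Fintype.sum_option, Matrix.of_apply, sub_mul,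
      mul_sub, Finset.sum_sub_distrib]
    simp [hcard, Matrix.one_apply]
    split_ifs <;> ring

theorem det_switchingMatrix_ne_zero (V : Type*) [Fintype V] [DecidableEq V] (m : ℕ)
    (hm : m ≠ 0) (hcard : Fintype.card V = 2 * m) : (switchingMatrix V m).det ≠ 0 := by
  intro h
  have := congrArg Matrix.det (switchingMatrix_mul_self V m hcard)
  rw [Matrix.det_mul, h, Matrix.det_smul, Matrix.det_one] at this
  simp only [mul_zero, mul_one] at this
  exact absurd this.symm (by positivity)

/-- Godsil–McKay switching: let `Γ` be a `k`-regular graph on `2m` vertices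
and `S` a set of `m` vertices.  The graph `Γ'` obtained by adding a new vertex joined
exactly to `S`, and the graph `Γ''` obtained by joining the new vertex to the complement
of `S` instead, are isospectral: their adjacency matrices have the same characteristic
polynomial. -/
theorem stmt11 (V : Type*) [Fintype V] [DecidableEq V]
    (Γ : SimpleGraph V) [DecidableRel Γ.Adj]
    (k m : ℕ) (hreg : Γ.IsRegularOfDegree k) (hcard : Fintype.card V = 2 * m)
    (S : Finset V) (hS : S.card = m) :
    (Matrix.of (fun a b : Option V =>
      match a, b with
      | some v, some w => if Γ.Adj v w then (1 : ℤ) else 0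
      | some v, none => if v ∈ S then 1 else 0
      | none, some w => if w ∈ S then 1 else 0
      | none, none => 0)).charpoly =
    (Matrix.of (fun a b : Option V =>
      match a, b with
      | some v, some w => if Γ.Adj v w then (1 : ℤ) else 0
      | some v, none => if v ∉ S then 1 else 0
      | none, some w => if w ∉ S then 1 else 0
      | none, none => 0)).charpoly := by
  rcases Nat.eq_zero_or_pos m with rfl | hm
  · have : IsEmpty V := Fintype.card_eq_zero_iff.mp (by simpa using hcard)
    congr 1
    ext a b
    rcases a with _ | v
    · rcases b with _ | w
      · rfl
      · exact isEmptyElim w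
    · exact isEmptyElim v
  have hrow (v : V) : ∑ x, (if Γ.Adj v x then (1 : ℤ) else 0) = k := by
    rw [Finset.sum_boole, ← SimpleGraph.neighborFinset_eq_filter, Γ.card_neighborFinset_eq_degree,
      hreg v]
  have hcol (w : V) : ∑ x, (if Γ.Adj x w then (1 : ℤ) else 0) = k := by
    simpa only [Γ.adj_comm w] using hrow w
  have hmem : ∑ x, (if x ∈ S then (1 : ℤ) else 0) = m := by simp [hS]
  have hnotMem : ∑ x, (if x ∉ S then (1 : ℤ) else 0) = m := by
    have h (x : V) : (if x ∉ S then (1 : ℤ) else 0) = 1 - if x ∈ S then 1 else 0 := by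
      split_ifs <;> simp_all
    simp only [h, Finset.sum_sub_distrib, hmem]
    simp [hcard]
    ring
  refine Matrix.charpoly_eq_of_mul_eq_mul ?_ (det_switchingMatrix_ne_zero V m hm.ne' hcard)
  ext a b
  rcases a with _ | v <;> rcases b with _ | w <;>
    simp only [switchingMatrix, Option.elim_some, Option.elim_none, Matrix.mul_apply,
      Fintype.sum_option, Matrix.of_apply, sub_mul,
      mul_sub, Finset.sum_sub_distrib, mul_one, one_mul, hrow, hcol, hmem, hnotMem]
  · simp
  · simp
    split_ifs <;> simp
  · simp
    rw [Finset.sum_eq_single v] <;> simp +contextual [eq_comm]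
    split_ifs <;> simp
  · simp
    rw [Finset.sum_eq_single v] <;> simp +contextual [eq_comm]
end

section
/- Let X and Y be finite simple graphs, and let f : V(X) ⊔ V(Y) → V(X) ⊔ V(Y) be a function such that f maps V(X) into V(Y) and V(Y) into V(X), and such that for every pair of vertices v, w lying in the same graph, rel(v,w) = rel(f(v), f(w)). Then |V(X)| = |V(Y)| and the restriction of f to V(X) is a graph isomorphism from X onto Y (a bijection f₁ : V(X) → V(Y) with (v,w) ∈ E(X) if and only if (f₁(v), f₁(w)) ∈ E(Y)). -/
open Finset

/-- Equal `rel` values on a pair in `X` and a pair in `Y` mean equal equality and adjacency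
relations. -/
theorem relS_inl_eq_relS_inr {VX VY : Type*} [DecidableEq VX] [DecidableEq VY]
    {X : SimpleGraph VX} {Y : SimpleGraph VY} [DecidableRel X.Adj] [DecidableRel Y.Adj]
    {v w : VX} {a b : VY}
    (h : relS X Y (Sum.inl v) (Sum.inl w) = relS X Y (Sum.inr a) (Sum.inr b)) :
    (v = w ↔ a = b) ∧ (X.Adj v w ↔ Y.Adj a b) := by
  have hX : X.Adj v w → v ≠ w := fun h => h.ne
  have hY : Y.Adj a b → a ≠ b := fun h => h.ne
  simp only [relS] at h
  split_ifs at h <;> simp_all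

/-- a perfect deterministic strategy `f` for the graph isomorphism game
(a map on `V(X) ⊔ V(Y)` interchanging the two graphs and preserving `rel` on same-graph
pairs) forces `|V(X)| = |V(Y)|`, and its restriction to `V(X)` is a graph isomorphism
from `X` onto `Y`. -/
theorem stmt12 {VX VY : Type*} [Fintype VX] [Fintype VY]
    [DecidableEq VX] [DecidableEq VY]
    (X : SimpleGraph VX) (Y : SimpleGraph VY)
    [DecidableRel X.Adj] [DecidableRel Y.Adj]
    (f : VX ⊕ VY → VX ⊕ VY)
    (hXY : ∀ g : VX, (f (Sum.inl g)).isRight = true)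
    (hYX : ∀ h : VY, (f (Sum.inr h)).isLeft = true)
    (hrelX : ∀ v w : VX,
      relS X Y (Sum.inl v) (Sum.inl w) = relS X Y (f (Sum.inl v)) (f (Sum.inl w)))
    (hrelY : ∀ v w : VY,
      relS X Y (Sum.inr v) (Sum.inr w) = relS X Y (f (Sum.inr v)) (f (Sum.inr w))) :
    Fintype.card VX = Fintype.card VY ∧
    ∃ f₁ : VX → VY, Function.Bijective f₁ ∧
      (∀ v : VX, f (Sum.inl v) = Sum.inr (f₁ v)) ∧
      (∀ v w : VX, X.Adj v w ↔ Y.Adj (f₁ v) (f₁ w)) := by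
  choose f₁ hf₁ using fun v => Sum.isRight_iff.mp (hXY v)
  choose f₂ hf₂ using fun v => Sum.isLeft_iff.mp (hYX v)
  have hX (v w : VX) : (v = w ↔ f₁ v = f₁ w) ∧ (X.Adj v w ↔ Y.Adj (f₁ v) (f₁ w)) :=
    relS_inl_eq_relS_inr (by rw [hrelX, hf₁, hf₁])
  have hY (v w : VY) : (f₂ v = f₂ w ↔ v = w) ∧ (X.Adj (f₂ v) (f₂ w) ↔ Y.Adj v w) :=
    relS_inl_eq_relS_inr (by rw [hrelY, hf₂, hf₂])
  have inj₁ : Function.Injective f₁ := fun v w h => (hX v w).1.mpr h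
  have inj₂ : Function.Injective f₂ := fun v w h => (hY v w).1.mp h
  have hcard : Fintype.card VX = Fintype.card VY :=
    (Fintype.card_le_of_injective f₁ inj₁).antisymm (Fintype.card_le_of_injective f₂ inj₂)
  exact ⟨hcard, f₁, (Fintype.bijective_iff_injective_and_card f₁).mpr ⟨inj₁, hcard⟩, hf₁,
    fun v w => (hX v w).2⟩
end

section
/- Let A be an m × n matrix over ℤ/2ℤ and b ∈ (ℤ/2ℤ)ᵐ, and let R be a unital *-ring containing a syncBCS(A,b)-family (e_{i,x}). For i ∈ {1,…,m}, x ∈ S_i^b and j ∈ {1,…,m}, y ∈ S_j^0, define q_{(i,x),(j,y)} = e_{i, x+y} if i = j and q_{(i,x),(j,y)} = 0 if i ≠ j. Then: (a) for every i and x ∈ S_i^b, Σ_{j=1}^m Σ_{y ∈ S_j^0} q_{(i,x),(j,y)} = 1; (b) for every j and y ∈ S_j^0, Σ_{i=1}^m Σ_{x ∈ S_i^b} q_{(i,x),(j,y)} = 1; (c) if q_{(i,x),(j,y)} q_{(i',x'),(j',y')} ≠ 0, then (i,x) = (i',x') if and only if (j,y) = (j',y'), and the pair (i,x),(i',x') is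 inconsistent if and only if the pair (j,y),(j',y') is inconsistent. -/
open Finset

/-- The support `V_i = {j : a_{i,j} ≠ 0}` of the `i`-th equation of the linear system. -/
def Vset {m n : ℕ} (A : Matrix (Fin m) (Fin n) (ZMod 2)) (i : Fin m) : Finset (Fin n) :=
  Finset.univ.filter (fun j => A i j ≠ 0)

/-- The solution set `S_i^c` of the `i`-th equation `Σ_{j ∈ V_i} a_{i,j} x_j = c_i` of the
linear system, with the variables off `V_i` required to vanish. -/
def Ssol {m n : ℕ} (A : Matrix (Fin m) (Fin n) (ZMod 2)) (c : Fin m → ZMod 2) (i : Fin m) :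
    Finset (Fin n → ZMod 2) :=
  Finset.univ.filter
    (fun x => (∑ j ∈ Vset A i, A i j * x j) = c i ∧ ∀ j ∉ Vset A i, x j = 0)

/-- `(i,x)` and `(i',x')` are inconsistent solutions: some `k ∈ V_i ∩ V_{i'}` has
`x_k ≠ x'_k`. -/
def Inconsist {m n : ℕ} (A : Matrix (Fin m) (Fin n) (ZMod 2))
    (i : Fin m) (x : Fin n → ZMod 2) (i' : Fin m) (x' : Fin n → ZMod 2) : Prop :=
  ∃ k, A i k ≠ 0 ∧ A i' k ≠ 0 ∧ x k ≠ x' k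

/-- A `syncBCS(A,b)`-family in a unital `*`-ring `R`. -/
structure SyncBCSFamily {m n : ℕ} (A : Matrix (Fin m) (Fin n) (ZMod 2))
    (b : Fin m → ZMod 2) (R : Type*) [Ring R] [StarRing R] where
  e : Fin m → (Fin n → ZMod 2) → R
  selfadj : ∀ i x, star (e i x) = e i x
  idem : ∀ i x, e i x * e i x = e i x
  supp : ∀ i x, x ∉ Ssol A b i → e i x = 0
  rowsum : ∀ i, ∑ x, e i x = 1
  orth : ∀ i x y, x ≠ y → e i x * e i y = 0
  incon : ∀ i j x y, Inconsist A i x j y → e i x * e j y = 0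

theorem add_mem_Ssol_iff {m n : ℕ} {A : Matrix (Fin m) (Fin n) (ZMod 2)} {c : Fin m → ZMod 2}
    (d : Fin m → ZMod 2) {i : Fin m} {x : Fin n → ZMod 2} (hx : x ∈ Ssol A c i)
    (y : Fin n → ZMod 2) : x + y ∈ Ssol A (c + d) i ↔ y ∈ Ssol A d i := by
  simp only [Ssol, mem_filter, mem_univ, true_and] at hx ⊢
  obtain ⟨hsum, hoff⟩ := hx
  simp only [Pi.add_apply, mul_add, sum_add_distrib, hsum, add_right_inj]
  refine and_congr_right fun _ => forall₂_congr fun j hj => ?_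
  rw [hoff j hj, zero_add]

namespace SyncBCSFamily

variable {m n : ℕ} {A : Matrix (Fin m) (Fin n) (ZMod 2)} {b : Fin m → ZMod 2}
  {R : Type*} [Ring R] [StarRing R] (E : SyncBCSFamily A b R)

/-- Translating a row of the family by a solution leaves its sum unchanged. -/
theorem sum_translate {c d : Fin m → ZMod 2} (hcd : c + d = b) {i : Fin m}
    {x : Fin n → ZMod 2} (hx : x ∈ Ssol A c i) : ∑ y ∈ Ssol A d i, E.e i (x + y) = 1 := by
  subst hcd
  rw [← E.rowsum i, ← Equiv.sum_comp (Equiv.addLeft x) (E.e i)]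
  exact sum_subset (subset_univ _) fun y _ hy =>
    E.supp i _ fun h => hy ((add_mem_Ssol_iff d hx y).1 h)

theorem eq_of_mul_ne_zero {i : Fin m} {x y : Fin n → ZMod 2} (h : E.e i x * E.e i y ≠ 0) :
    x = y :=
  not_imp_comm.1 (E.orth i x y) h

theorem not_inconsist_of_mul_ne_zero {i j : Fin m} {x y : Fin n → ZMod 2}
    (h : E.e i x * E.e j y ≠ 0) : ¬Inconsist A i x j y :=
  fun hinc => h (E.incon i j x y hinc)

end SyncBCSFamily

theorem Inconsist.of_not_inconsist_add {m n : ℕ} {A : Matrix (Fin m) (Fin n) (ZMod 2)}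
    {i j : Fin m} {x y u v : Fin n → ZMod 2} (hxy : Inconsist A i x j y)
    (hadd : ¬Inconsist A i (x + u) j (y + v)) : Inconsist A i u j v := by
  obtain ⟨k, hi, hj, hk⟩ := hxy
  refine ⟨k, hi, hj, fun huv => hadd ⟨k, hi, hj, ?_⟩⟩
  simpa [huv] using hk

/-- the elements `q_{(i,x),(j,y)}` built from a `syncBCS(A,b)`-family form
a "magic"-type array: rows and columns sum to `1`, and nonvanishing products preserve
both equality and inconsistency of pairs. -/
theorem stmt14 {m n : ℕ} (A : Matrix (Fin m) (Fin n) (ZMod 2)) (b : Fin m → ZMod 2)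
    (R : Type*) [Ring R] [StarRing R] (E : SyncBCSFamily A b R) :
    let q : Fin m → (Fin n → ZMod 2) → Fin m → (Fin n → ZMod 2) → R :=
      fun i x j y => if i = j then E.e i (x + y) else 0
    (∀ i, ∀ x ∈ Ssol A b i, ∑ j, ∑ y ∈ Ssol A 0 j, q i x j y = 1) ∧
    (∀ j, ∀ y ∈ Ssol A 0 j, ∑ i, ∑ x ∈ Ssol A b i, q i x j y = 1) ∧
    (∀ i x i' x' j y j' y', x ∈ Ssol A b i → x' ∈ Ssol A b i' →
      y ∈ Ssol A 0 j → y' ∈ Ssol A 0 j' →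
      q i x j y * q i' x' j' y' ≠ 0 →
      (((i, x) = (i', x')) ↔ ((j, y) = (j', y'))) ∧
      (Inconsist A i x i' x' ↔ Inconsist A j y j' y')) := by
  intro q
  refine ⟨fun i x hx => ?_, fun j y hy => ?_, ?_⟩
  · rw [Fintype.sum_eq_single i fun j hj => sum_eq_zero fun y _ => if_neg hj.symm]
    simpa [q] using E.sum_translate (add_zero b) hx
  · rw [Fintype.sum_eq_single j fun i hi => sum_eq_zero fun x _ => if_neg hi]
    simpa [q, add_comm] using E.sum_translate (zero_add b) hy
  · intro i x i' x' j y j' y' _ _ _ _ hq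
    obtain rfl : i = j := by
      by_contra h
      exact hq (by simp [q, h])
    obtain rfl : i' = j' := by
      by_contra h
      exact hq (by simp [q, h])
    simp only [q, if_true] at hq
    have hcons := E.not_inconsist_of_mul_ne_zero hq
    refine ⟨?_, fun h => h.of_not_inconsist_add hcons, fun h => h.of_not_inconsist_add ?_⟩
    · simp only [Prod.mk.injEq]
      refine and_congr_right fun hi => ?_
      subst hi
      have hxy := E.eq_of_mul_ne_zero hq
      constructor
      · rintro rfl
        exact add_left_cancel hxy
      · rintro rfl
        exact add_right_cancel hxy
    · rwa [add_comm y, add_comm y']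
end
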